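/- Blow-up of a submanifold with boundary at a boundary point: let 1 ≤ k ≤ n−1, let O ⊆ ℍ^n be open, let S ⊆ ℍ^n be a k-codimensional C¹_ℍ-regular submanifold with boundary in O, let p ∈ O ∩ ∂S, and let f₁,…,f_{k+1} ∈ C¹_ℍ(U) be locally defining functions on a neighbourhood U of p with linearly independent horizontal gradients, U ∩ S = {f₁=⋯=f_k=0, f_{k+1}>0} and f₁(p)=⋯=f_{k+1}(p)=0. Then, as λ → 0, δ_{1/λ}(p⁻¹·S) converges in the sense of local Hausdorff convergence of sets to T^ℍ_p S ∩ {q ∈ ℍ^n : (d_ℍ f_{k+1})_p(q) > 0}, and moreover T^ℍ_p ∂S = T^ℍ_p S ∩ {q ∈ ℍ^n : (d_ℍ f_{k+1})_p(q) = 0}. -/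

import Mathlib

open MeasureTheory Topology Filter Set ENNReal

noncomputable section
namespace Heis

/-- Points of the `n`-th Heisenberg group `ℍⁿ ≡ ℝⁿ × ℝⁿ × ℝ`, `p = (x, y, t)`. -/
abbrev Hpt (n : ℕ) : Type := (Fin n → ℝ) × (Fin n → ℝ) × ℝ

variable {n : ℕ}

/-- The Heisenberg group operation. -/
def hmul (p q : Hpt n) : Hpt n :=
  (p.1 + q.1, p.2.1 + q.2.1,
    p.2.2 + q.2.2 + (∑ j, p.1 j * q.2.1 j) / 2 - (∑ j, q.1 j * p.2.1 j) / 2)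

/-- Group inverse. -/
def hinv (p : Hpt n) : Hpt n := (-p.1, -p.2.1, -p.2.2)

/-- Anisotropic dilations `δ_λ(x,y,t) = (λx, λy, λ²t)`. -/
def hdil (l : ℝ) (p : Hpt n) : Hpt n := (l • p.1, l • p.2.1, l ^ 2 * p.2.2)

/-- The value at `p` of the `j`-th left invariant frame field `X₁,…,Xₙ,Y₁,…,Yₙ,T`,
expressed in the coordinates of `ℝ^{2n+1}`. -/
def frameVec (j : Fin (2*n+1)) (p : Hpt n) : Hpt n :=
  if h : (j : ℕ) < n then
    (Pi.single (⟨j, h⟩ : Fin n) 1, 0, -(p.2.1 ⟨j, h⟩) / 2)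
  else if h' : (j : ℕ) < 2*n then
    (0, Pi.single (⟨(j:ℕ) - n, by omega⟩ : Fin n) 1, p.1 ⟨(j:ℕ) - n, by omega⟩ / 2)
  else (0, 0, 1)

/-- Inclusion of horizontal indices. -/
def hIdx (j : Fin (2*n)) : Fin (2*n+1) := Fin.castLE (by omega) j

/-- Horizontal gradient `∇_ℍ f = (X₁f,…,Xₙf,Y₁f,…,Yₙf)` (pointwise derivatives along the
horizontal left-invariant fields). -/
def gradH (f : Hpt n → ℝ) (p : Hpt n) : Fin (2*n) → ℝ :=
  fun j => lineDeriv ℝ f p (frameVec (hIdx j) p)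

/-- `f` is of class `C¹_ℍ` on `U`: it is continuous and its horizontal derivatives exist and
are (represented by) continuous functions on `U`. -/
structure IsC1H (U : Set (Hpt n)) (f : Hpt n → ℝ) : Prop where
  contOn : ContinuousOn f U
  ldiff : ∀ p ∈ U, ∀ j : Fin (2*n), LineDifferentiableAt ℝ f p (frameVec (hIdx j) p)
  contGrad : ∀ j : Fin (2*n), ContinuousOn (fun p => gradH f p j) U

/-- Horizontal gradient as a frame-coefficient vector in `ℝ^{2n+1}` (with zero `T`-component). -/
def gradF (f : Hpt n → ℝ) (q : Hpt n) : Fin (2*n+1) → ℝ :=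
  fun j => if h : (j:ℕ) < 2*n then gradH f q ⟨j, h⟩ else 0

/-- Horizontal derivative indexed by a natural number (0 outside the horizontal range). -/
def gradNat (f : Hpt n → ℝ) (q : Hpt n) (i : ℕ) : ℝ :=
  if h : i < 2*n then gradH f q ⟨i, h⟩ else 0

/-- The Pansu differential of a `C¹_ℍ` function: `d_ℍf_p(x,y,t) = Σⱼ(xⱼXⱼf(p) + yⱼYⱼf(p))`. -/
def pansuD (f : Hpt n → ℝ) (p : Hpt n) (q : Hpt n) : ℝ :=
  ∑ j : Fin n, (q.1 j * gradH f p ⟨(j:ℕ), by omega⟩ + q.2.1 j * gradH f p ⟨n + (j:ℕ), by omega⟩)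

/-- `S` is a `k`-codimensional `C¹_ℍ`-regular submanifold. -/
def IsC1HCodim (k : ℕ) (S : Set (Hpt n)) : Prop :=
  ∀ p ∈ S, ∃ U : Set (Hpt n), IsOpen U ∧ p ∈ U ∧
    ∃ f : Fin k → Hpt n → ℝ,
      (∀ i, IsC1H U (f i)) ∧
      (∀ q ∈ U, LinearIndependent ℝ (fun i => gradH (f i) q)) ∧
      S ∩ U = {q ∈ U | ∀ i, f i q = 0}

/-- `L : ℝ^k → ℍⁿ` is a group homomorphism. -/
def IsGroupHomH {k : ℕ} (L : (Fin k → ℝ) → Hpt n) : Prop :=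
  ∀ a b, L (a + b) = hmul (L a) (L b)

/-- Pansu differentiability of `f : ℝ^k → ℍⁿ` at `a`:
`δ_{1/λ}(f(a)⁻¹ ⬝ f(a + λb)) → L(b)` locally uniformly in `b`, with `L` a group homomorphism. -/
def HasPansuDerivAt {k : ℕ} (f : (Fin k → ℝ) → Hpt n) (L : (Fin k → ℝ) → Hpt n)
    (a : Fin k → ℝ) : Prop :=
  IsGroupHomH L ∧
    TendstoLocallyUniformly
      (fun (l : ℝ) (b : Fin k → ℝ) => hdil l⁻¹ (hmul (hinv (f a)) (f (a + l • b)))) L (𝓝[>] 0)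

/-- `S` is a `k`-dimensional (`k ≤ n`) `C¹_ℍ`-regular submanifold: locally the injective image
of an open set of `ℝ^k` under a continuously Pansu differentiable map with injective
Pansu differential. -/
def IsC1HDim (k : ℕ) (S : Set (Hpt n)) : Prop :=
  ∀ p ∈ S, ∃ U : Set (Hpt n), IsOpen U ∧ p ∈ U ∧
    ∃ V : Set (Fin k → ℝ), IsOpen V ∧
    ∃ (f : (Fin k → ℝ) → Hpt n) (Df : (Fin k → ℝ) → (Fin k → ℝ) → Hpt n),
      Set.InjOn f V ∧ Set.MapsTo f V U ∧
      (∀ a ∈ V, HasPansuDerivAt f (Df a) a ∧ Function.Injective (Df a)) ∧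
      (∀ b, ContinuousOn (fun a => Df a b) V) ∧
      S ∩ U = f '' V

/-- `C¹_ℍ`-regular submanifold of codimension `k`, for any `1 ≤ k ≤ 2n+1` (for `k ≥ n+1` this
means a low-dimensional submanifold of dimension `2n+1-k`). -/
def IsC1HSub (k : ℕ) (S : Set (Hpt n)) : Prop :=
  if k ≤ n then IsC1HCodim k S else IsC1HDim (2*n+1-k) S

/-! ## Distances and measures -/

/-- Open ball of a distance function. -/
def rawBall (d : Hpt n → Hpt n → ℝ) (p : Hpt n) (r : ℝ) : Set (Hpt n) := {q | d p q < r}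

/-- The gauge used to define the spherical Hausdorff measure of dimension `m` at scale `r`. -/
def sphGauge (d : Hpt n → Hpt n → ℝ) (m r : ℝ) (s : Set (Hpt n)) : ℝ≥0∞ :=
  ⨅ (c : Hpt n) (ρ : ℝ) (_ : 0 < ρ) (_ : ρ < r) (_ : s ⊆ rawBall d c ρ),
    ENNReal.ofReal ((2*ρ) ^ m)

/-- Spherical pre-measure at scale `r`. -/
def sphPre (d : Hpt n → Hpt n → ℝ) (m r : ℝ) : OuterMeasure (Hpt n) :=
  OuterMeasure.boundedBy (sphGauge d m r)

/-- The spherical Hausdorff outer measure `𝒮^m` associated with `d`. -/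
def sphOuter (d : Hpt n → Hpt n → ℝ) (m : ℝ) : OuterMeasure (Hpt n) :=
  ⨆ (r : ℝ) (_ : 0 < r), sphPre d m r

/-- A left invariant, homogeneous, rotationally invariant distance on `ℍⁿ`.
(The field `carat` records the — automatically true — fact that Borel sets are
Carathéodory measurable for the associated spherical measures.) -/
structure HomDist (n : ℕ) where
  d : Hpt n → Hpt n → ℝ
  symm : ∀ p q, d p q = d q p
  triangle : ∀ p q r, d p r ≤ d p q + d q r
  eq_iff : ∀ p q, d p q = 0 ↔ p = q
  leftInv : ∀ g p q, d (hmul g p) (hmul g q) = d p q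
  homog : ∀ l : ℝ, 0 < l → ∀ p q, d (hdil l p) (hdil l q) = l * d p q
  rotInv : ∀ p q : Hpt n,
    (∑ j, (p.1 j ^ 2 + p.2.1 j ^ 2)) = (∑ j, (q.1 j ^ 2 + q.2.1 j ^ 2)) →
    p.2.2 = q.2.2 → d 0 p = d 0 q
  carat : ∀ m : ℝ,
    (inferInstance : MeasurableSpace (Hpt n)) ≤ (sphOuter d m).caratheodory

/-- Open ball `U(p,r)` of a homogeneous distance. -/
def hball (D : HomDist n) (p : Hpt n) (r : ℝ) : Set (Hpt n) := rawBall D.d p r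

/-- The spherical Hausdorff measure `𝒮^m` of a homogeneous distance, as a measure. -/
def sphMeasure (D : HomDist n) (m : ℝ) : Measure (Hpt n) :=
  (sphOuter D.d m).toMeasure (D.carat m)

/-- `μ⌊A` is locally finite on `O`. -/
def LocFin (μ : Measure (Hpt n)) (A O : Set (Hpt n)) : Prop :=
  ∀ p ∈ O, ∃ U : Set (Hpt n), IsOpen U ∧ p ∈ U ∧ μ (A ∩ U) < ⊤

/-! ## Euclidean coordinates and Euclidean Hausdorff measures -/

/-- Realization of a coordinate vector `c ∈ ℝ^{2n+1}` as a point/tangent vector of `ℍⁿ`. -/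
def rE (c : Fin (2*n+1) → ℝ) : Hpt n :=
  (fun i => c ⟨(i:ℕ), by omega⟩, fun i => c ⟨n + (i:ℕ), by omega⟩, c ⟨2*n, by omega⟩)

/-- Coordinates of a point/tangent vector of `ℍⁿ` as a vector of `ℝ^{2n+1}`. -/
def toEc (q : Hpt n) : Fin (2*n+1) → ℝ := fun j =>
  if h : (j:ℕ) < n then q.1 ⟨j, h⟩
  else if h' : (j:ℕ) < 2*n then q.2.1 ⟨(j:ℕ) - n, by omega⟩
  else q.2.2

/-- Identification of `ℍⁿ` with the Euclidean space `ℝ^{2n+1}`. -/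
def ofE (q : EuclideanSpace ℝ (Fin (2*n+1))) : Hpt n := rE (fun j => q j)

/-- The `m`-dimensional Euclidean Hausdorff measure on `ℍⁿ ≡ ℝ^{2n+1}`. -/
def muE (n : ℕ) (m : ℝ) : Measure (Hpt n) :=
  Measure.map ofE (μH[m] : Measure (EuclideanSpace ℝ (Fin (2*n+1))))

/-! ## Multivectors -/

/-- Index sets for a basis of `Λ_k 𝔥`. -/
def IdxSet (n k : ℕ) := {s : Finset (Fin (2*n+1)) // s.card = k}

instance (n k : ℕ) : Fintype (IdxSet n k) := by unfold IdxSet; infer_instance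

/-- The increasing enumeration of an index set. -/
def idxTuple {k : ℕ} (s : IdxSet n k) (i : Fin k) : Fin (2*n+1) :=
  ((s.1.orderIsoOfFin s.2) i).1

/-- `k`-vectors, as coefficients with respect to the canonical basis of `Λ_k ℝ^{2n+1}`. -/
abbrev MVec (n k : ℕ) := IdxSet n k → ℝ

/-- The simple `k`-vector `v₁ ∧ ⋯ ∧ v_k`. -/
def simpleWedge {k : ℕ} (v : Fin k → (Fin (2*n+1) → ℝ)) : MVec n k :=
  fun s => Matrix.det (Matrix.of fun i j => v i (idxTuple s j))

/-- Degree cast for multivectors. -/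
def mvCast {a b : ℕ} (h : a = b) (t : MVec n a) : MVec n b :=
  fun s => t ⟨s.1, by rw [h]; exact s.2⟩

/-- Euclidean scalar product of coefficient vectors. -/
def dotC (a b : Fin (2*n+1) → ℝ) : ℝ := ∑ j, a j * b j

/-- Pairing `⟨t | η⟩` at `p` of a `k`-vector (in the left invariant frame `X₁,…,Yₙ,T`)
with a `k`-form. -/
def pairF {k : ℕ} (t : MVec n k) (p : Hpt n) (η : (Fin k → Hpt n) → ℝ) : ℝ :=
  ∑ s, t s * η (fun i => frameVec (idxTuple s i) p)

/-- The `j`-th coordinate basis vector of `ℝ^{2n+1}`. -/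
def coordC (j : Fin (2*n+1)) : Fin (2*n+1) → ℝ := fun j' => if j' = j then 1 else 0

/-- Pairing `⟨t | η⟩` of a `k`-vector (in the coordinate basis `∂x,∂y,∂t`) with a `k`-form. -/
def pairE {k : ℕ} (t : MVec n k) (η : (Fin k → Hpt n) → ℝ) : ℝ :=
  ∑ s, t s * η (fun i => rE (coordC (idxTuple s i)))

/-- Realization of a frame-coefficient vector as a tangent vector at `p`. -/
def rF (c : Fin (2*n+1) → ℝ) (p : Hpt n) : Hpt n := ∑ j, c j • frameVec j p

/-! ## Covectors and Heisenberg forms -/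

/-- `k`-covectors on `ℍⁿ`. -/
abbrev Cov (n k : ℕ) := AlternatingMap ℝ (Hpt n) ℝ (Fin k)

/-- Wedge product of covectors. -/
def cwedge {k l : ℕ} (α : Cov n k) (β : Cov n l) : Cov n (k + l) :=
  AlternatingMap.domDomCongr finSumFinEquiv
    ((TensorProduct.lid ℝ ℝ).toLinearMap.compAlternatingMap (AlternatingMap.domCoprod α β))

/-- Degree cast for covectors. -/
def covCast {a b : ℕ} (h : a = b) (α : Cov n a) : Cov n b :=
  AlternatingMap.domDomCongr (finCongr h) α

def projX (j : Fin n) : Hpt n →ₗ[ℝ] ℝ := (LinearMap.proj j).comp (LinearMap.fst ℝ _ _)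

def projY (j : Fin n) : Hpt n →ₗ[ℝ] ℝ :=
  (LinearMap.proj j).comp ((LinearMap.fst ℝ _ _).comp (LinearMap.snd ℝ _ _))

def projT : Hpt n →ₗ[ℝ] ℝ := (LinearMap.snd ℝ _ _).comp (LinearMap.snd ℝ _ _)

/-- The contact form `θ = dt + ½Σⱼ(yⱼdxⱼ − xⱼdyⱼ)` at `p`, as a linear functional. -/
def thetaLin (p : Hpt n) : Hpt n →ₗ[ℝ] ℝ :=
  projT + (2:ℝ)⁻¹ • (∑ j : Fin n, (p.2.1 j • projX j - p.1 j • projY j))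

/-- A linear functional as a `1`-covector. -/
def cov1 (L : Hpt n →ₗ[ℝ] ℝ) : Cov n 1 :=
  AlternatingMap.ofSubsingleton ℝ (Hpt n) ℝ (0 : Fin 1) L

/-- `θ` as a `1`-covector. -/
def thetaC (p : Hpt n) : Cov n 1 := cov1 (thetaLin p)

/-- `dθ = −Σⱼ dxⱼ∧dyⱼ` as a (constant) `2`-covector. -/
def dthetaC : Cov n 2 := -∑ j : Fin n, cwedge (cov1 (projX j)) (cov1 (projY j))

/-- Membership in the Rumin ideal `ℐ^k = {λ∧θ + μ∧dθ}` at the point `p`. -/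
def memI {k : ℕ} (p : Hpt n) (ω : Cov n k) : Prop :=
  ∃ (a : Cov n (k-1)) (ω₂ : Cov n k) (h1 : (k-1)+1 = k),
    ω = covCast h1 (cwedge a (thetaC p)) + ω₂ ∧
    (ω₂ = 0 ∨ ∃ (b : Cov n (k-2)) (h2 : (k-2)+2 = k), ω₂ = covCast h2 (cwedge b dthetaC))

/-- Membership in `𝒥^k = {λ : λ∧θ = λ∧dθ = 0}` at the point `p`. -/
def memJ {k : ℕ} (p : Hpt n) (ω : Cov n k) : Prop :=
  cwedge ω (thetaC p) = 0 ∧ cwedge ω dthetaC = 0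

/-- A compactly supported smooth Heisenberg `k`-form on `O` (for `k ≤ n` the values are
representatives of classes modulo `ℐ^k`; for `k ≥ n+1` they lie in `𝒥^k`). -/
structure IsHFormD (k : ℕ) (O : Set (Hpt n)) (ω : Hpt n → Cov n k) : Prop where
  smooth : ∀ v : Fin k → Hpt n, ContDiff ℝ (⊤ : ℕ∞) fun p => ω p v
  cptSupp : ∃ K : Set (Hpt n), IsCompact K ∧ K ⊆ O ∧ ∀ p ∉ K, ω p = 0
  vert : n + 1 ≤ k → ∀ p, memJ p (ω p)

/-- Exterior derivative (as a raw multilinear expression):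
`dω_p(v₀,…,v_k) = Σᵢ (−1)ⁱ ∂_{vᵢ}(q ↦ ω_q(v₀,…,v̂ᵢ,…,v_k))(p)`. -/
def extD {k : ℕ} (ω : Hpt n → Cov n k) (p : Hpt n) (v : Fin (k+1) → Hpt n) : ℝ :=
  ∑ i : Fin (k+1), (-1 : ℝ)^(i:ℕ) * fderiv ℝ (fun q => ω q (v ∘ i.succAbove)) p (v i)

/-- `η` is the Rumin operator `D` applied to `ω` (only meaningful in degree `k = n`):
`Dω = d(ω − θ∧β)` where `β = L⁻¹((dω)_{𝔥₁})`, i.e. `β` is horizontal and `β∧dθ` agrees with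
`dω` on horizontal vectors. -/
def IsRuminD {k : ℕ} (ω : Hpt n → Cov n k) (η : Hpt n → (Fin (k+1) → Hpt n) → ℝ) : Prop :=
  ∃ (β : Hpt n → Cov n (k-1)) (h1 : 1 + (k-1) = k) (h2 : (k-1)+2 = k+1),
    (∀ v, ContDiff ℝ (⊤ : ℕ∞) fun p => β p v) ∧
    (∀ (p : Hpt n) (v : Fin (k-1) → Hpt n) (i : Fin (k-1)),
      v i = ((0:Fin n → ℝ), (0:Fin n → ℝ), (1:ℝ)) → β p v = 0) ∧
    (∀ (p : Hpt n) (v : Fin (k+1) → Hpt n), (∀ i, thetaLin p (v i) = 0) →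
      extD ω p v = covCast h2 (cwedge (β p) dthetaC) v) ∧
    η = extD (fun p => ω p - covCast h1 (cwedge (thetaC p) (β p)))

/-- The Rumin differential `d_c`: the exterior derivative in degree `k ≠ n`, the second order
operator `D` in the critical degree `k = n`. -/
def IsDc {k : ℕ} (ω : Hpt n → Cov n k) (η : Hpt n → (Fin (k+1) → Hpt n) → ℝ) : Prop :=
  if k = n then IsRuminD ω η else η = extD ω

/-- Degree cast for raw forms. -/
def rawCast {a b : ℕ} (h : a = b) (η : (Fin a → Hpt n) → ℝ) : (Fin b → Hpt n) → ℝ :=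
  fun v => η (fun i => v (Fin.cast h i))

/-! ## Orientations and currents -/

/-- `t` is a unit tangent `m`-vector of the `k`-codimensional `C¹_ℍ` submanifold `S` at `p`,
i.e. `t = ±*n^ℍ_S(p)`: `t` is the wedge of an orthonormal basis of `ker d_ℍf_p`
(in the left invariant frame). -/
def IsHTangentVecAt (k m : ℕ) (S : Set (Hpt n)) (p : Hpt n) (t : MVec n m) : Prop :=
  ∃ (U : Set (Hpt n)) (f : Fin k → Hpt n → ℝ), IsOpen U ∧ p ∈ U ∧
    (∀ i, IsC1H U (f i)) ∧
    (∀ q ∈ U, LinearIndependent ℝ (fun i => gradH (f i) q)) ∧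
    S ∩ U = {q ∈ U | ∀ i, f i q = 0} ∧
    ∃ v : Fin m → (Fin (2*n+1) → ℝ),
      (∀ i j, dotC (v i) (v j) = if i = j then 1 else 0) ∧
      (∀ i l, dotC (v i) (gradF (f l) p) = 0) ∧
      t = simpleWedge v

/-- An orientation of a `k`-codimensional `C¹_ℍ` submanifold: a continuous global choice of
the unit tangent `(2n+1−k)`-vector `t^ℍ_S` (here of formal degree `m`). -/
def IsHOrient (k m : ℕ) (S : Set (Hpt n)) (t : Hpt n → MVec n m) : Prop :=
  ContinuousOn t S ∧ ∀ p ∈ S, IsHTangentVecAt k m S p (t p)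

/-- Classical Euclidean unit tangent `m`-vector at a point of an `m`-dimensional submanifold
(coefficients in the coordinate basis). -/
def IsEuclTangentVecAt (m : ℕ) (S : Set (Hpt n)) (p : Hpt n) (t : MVec n m) : Prop :=
  ∃ v : Fin m → (Fin (2*n+1) → ℝ),
    (∀ i j, dotC (v i) (v j) = if i = j then 1 else 0) ∧
    (∀ i, rE (v i) ∈ tangentConeAt ℝ S p) ∧ t = simpleWedge v

/-- Classical (Euclidean) orientation of a low-dimensional submanifold. -/
def IsEuclOrient (m : ℕ) (S : Set (Hpt n)) (t : Hpt n → MVec n m) : Prop :=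
  ContinuousOn t S ∧ ∀ p ∈ S, IsEuclTangentVecAt m S p (t p)

/-- The standard vertical subgroup `𝕎` of codimension `k`. -/
def Wstd (n k : ℕ) : Set (Hpt n) := {p | ∀ i : Fin n, (i:ℕ) < k → p.1 i = 0}

/-- Embedding realizing `𝕎` as a Euclidean space. -/
def wEmbed (n k : ℕ) (a : ({i : Fin n // k ≤ (i:ℕ)} → ℝ) × (Fin n → ℝ) × ℝ) : Hpt n :=
  (fun i => if h : k ≤ (i:ℕ) then a.1 ⟨i, h⟩ else 0, a.2.1, a.2.2)

/-- Lebesgue measure `ℒ^{2n+1−k}` on the vertical subgroup `𝕎`. -/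
def wLeb (n k : ℕ) : Measure (Hpt n) := Measure.map (wEmbed n k) volume

/-- The geometric constant
`C_{n,k} = (sup{ℒ^{2n+1−k}(𝕎 ∩ U(p,1)) : p ∈ U(0,1)})⁻¹`. -/
def CnkC (D : HomDist n) (k : ℕ) : ℝ :=
  (sSup {v : ℝ | ∃ p ∈ hball D 0 1, v = (wLeb n k (Wstd n k ∩ hball D p 1)).toReal})⁻¹

/-- The Heisenberg current `⟦S⟧` of an oriented `k`-codimensional (`k ≤ n`) submanifold:
`⟦S⟧(ω) = (1/C_{n,k}) ∫_S ⟨t^ℍ_S | ω⟩ d𝒮^{Q−k}`. -/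
def currF (D : HomDist n) (k : ℕ) (S : Set (Hpt n)) (t : Hpt n → MVec n (2*n+1-k))
    (η : Hpt n → (Fin (2*n+1-k) → Hpt n) → ℝ) : ℝ :=
  (CnkC D k)⁻¹ * ∫ p in S, pairF (t p) p (η p) ∂(sphMeasure D ((2*n+2 : ℝ) - (k : ℝ)))

/-- The current of an oriented low-dimensional (`m ≤ n`) submanifold: the classical integral
`⟦S⟧(ω) = ∫_S ⟨τ_S | ω⟩ d𝓗^m_E`. -/
def currE {n : ℕ} (m : ℕ) (S : Set (Hpt n)) (t : Hpt n → MVec n m)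
    (η : Hpt n → (Fin m → Hpt n) → ℝ) : ℝ :=
  ∫ p in S, pairE (t p) (η p) ∂(muE n (m : ℝ))

/-- The Heisenberg current of an oriented `m`-dimensional submanifold (any `m`). -/
def hCurr (D : HomDist n) (m : ℕ) (S : Set (Hpt n)) (t : Hpt n → MVec n m)
    (η : Hpt n → (Fin m → Hpt n) → ℝ) : ℝ :=
  if m ≤ n then currE m S t η
  else if h2 : m ≤ 2*n+1 then
    currF D (2*n+1-m) S (fun p => mvCast (by omega) (t p)) (fun p => rawCast (by omega) (η p))
  else 0

/-- Orientation of an `m`-dimensional submanifold (any `m`): Euclidean in low dimension,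
the continuous unit tangent field `t^ℍ_S` in low codimension. -/
def IsOrientS (m : ℕ) (S : Set (Hpt n)) (t : Hpt n → MVec n m) : Prop :=
  if m ≤ n then IsEuclOrient m S t else IsHOrient (2*n+1-m) m S t

/-! ## Submanifolds with boundary -/

/-- The boundary `∂S = S̄ ∖ S`. -/
def bdry (S : Set (Hpt n)) : Set (Hpt n) := closure S \ S

/-- `S` is a `k`-codimensional `C¹_ℍ`-regular submanifold with boundary in `O`. -/
def IsC1HSubWithBdry (D : HomDist n) (k : ℕ) (O : Set (Hpt n)) (S : Set (Hpt n)) : Prop :=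
  (O ∩ S).Nonempty ∧ IsC1HSub k (O ∩ S) ∧
  (O ∩ bdry S).Nonempty ∧ IsC1HSub (k+1) (O ∩ bdry S) ∧
  ∀ p ∈ O ∩ bdry S, ∃ U : Set (Hpt n), IsOpen U ∧ p ∈ U ∧
    ∃ S' : Set (Hpt n), S' ⊆ U ∧ IsC1HSub k S' ∧ U ∩ closure S ⊆ S' ∧
      ∀ r : ℝ, 0 < r → (hball D p r ∩ (S' \ closure S)).Nonempty

/-- A family `f₁,…,f_{k+1}` of local defining functions at a boundary point `p`, as in the
characterization of `k`-codimensional submanifolds with boundary: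
`U ∩ S = {f₁ = ⋯ = f_k = 0, f_{k+1} > 0}` and `f_{k+1}(p) = 0`. -/
def IsBdryFrame (k : ℕ) (S : Set (Hpt n)) (p : Hpt n) (U : Set (Hpt n))
    (f : Fin (k+1) → Hpt n → ℝ) : Prop :=
  IsOpen U ∧ p ∈ U ∧ (∀ i, IsC1H U (f i)) ∧
  (∀ q ∈ U, LinearIndependent ℝ (fun i => gradH (f i) q)) ∧
  U ∩ S = {q ∈ U | (∀ i : Fin k, f i.castSucc q = 0) ∧ 0 < f (Fin.last k) q} ∧
  f (Fin.last k) p = 0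

/-! ## Smooth and Euclidean submanifolds -/

/-- `S` is a smooth (Euclidean `C^∞`) submanifold of codimension `k`. -/
def IsSmoothCodim (k : ℕ) (S : Set (Hpt n)) : Prop :=
  ∀ p ∈ S, ∃ U : Set (Hpt n), IsOpen U ∧ p ∈ U ∧ ∃ f : Fin k → Hpt n → ℝ,
    (∀ i, ContDiff ℝ (⊤ : ℕ∞) (f i)) ∧
    (∀ q ∈ U, LinearIndependent ℝ (fun i => fderiv ℝ (f i) q)) ∧
    S ∩ U = {q ∈ U | ∀ i, f i q = 0}

/-- `S` is a Euclidean `C¹` submanifold of codimension `k`. -/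
def IsC1ECodim (k : ℕ) (S : Set (Hpt n)) : Prop :=
  ∀ p ∈ S, ∃ U : Set (Hpt n), IsOpen U ∧ p ∈ U ∧ ∃ f : Fin k → Hpt n → ℝ,
    (∀ i, ContDiff ℝ 1 (f i)) ∧
    (∀ q ∈ U, LinearIndependent ℝ (fun i => fderiv ℝ (f i) q)) ∧
    S ∩ U = {q ∈ U | ∀ i, f i q = 0}

/-- `M` is a Euclidean `k`-dimensional `C¹` submanifold with boundary (`M` closed in its
charts; boundary charts are half-spaces). -/
def IsC1EuclSubWithBdryDim (k : ℕ) (M : Set (Hpt n)) : Prop :=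
  ∀ p ∈ M, ∃ (V : Set (Fin k → ℝ)) (φ : (Fin k → ℝ) → Hpt n) (U : Set (Hpt n)) (a : Fin k → ℝ)
      (i₀ : Fin k),
    IsOpen V ∧ IsOpen U ∧ p ∈ U ∧ a ∈ V ∧ φ a = p ∧
    ContDiffOn ℝ 1 φ V ∧ Set.InjOn φ V ∧
    (∀ b ∈ V, Function.Injective (fderivWithin ℝ φ V b)) ∧
    (M ∩ U = φ '' (V ∩ {x | 0 ≤ x i₀}) ∨ M ∩ U = φ '' V)

/-! ## Isometries -/

/-- A rotation of the horizontal layer: a linear group automorphism commuting with dilations,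
preserving the vertical coordinate and the horizontal Euclidean norm. -/
def IsRotation (R : Hpt n → Hpt n) : Prop :=
  IsLinearMap ℝ R ∧ (∀ p q, R (hmul p q) = hmul (R p) (R q)) ∧
  (∀ l p, R (hdil l p) = hdil l (R p)) ∧
  (∀ p, (R p).2.2 = p.2.2) ∧
  (∀ p, (∑ j, ((R p).1 j ^ 2 + (R p).2.1 j ^ 2)) = ∑ j, (p.1 j ^ 2 + p.2.1 j ^ 2))

/-- An isometry of `ℍⁿ`: the composition of a left translation and a rotation. -/
def IsHIsom (φ : Hpt n → Hpt n) : Prop :=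
  ∃ (g : Hpt n) (R : Hpt n → Hpt n), IsRotation R ∧ φ = fun p => hmul g (R p)

/-! ## Tangent cones and blow-ups -/

/-- The tangent cone `T^ℍ_0 E` at the origin. -/
def tangentConeH (E : Set (Hpt n)) : Set (Hpt n) :=
  {x | ∃ (xh : ℕ → Hpt n) (rh : ℕ → ℝ), (∀ h, xh h ∈ E) ∧ Tendsto rh atTop atTop ∧
        Tendsto (fun h => hdil (rh h) (xh h)) atTop (𝓝 x)}

/-- The tangent cone `T^ℍ_p E = T^ℍ_0(p⁻¹ ⬝ E)`. -/
def tangentConeHAt (E : Set (Hpt n)) (p : Hpt n) : Set (Hpt n) :=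
  tangentConeH ((fun q => hmul (hinv p) q) '' E)

/-- Local Hausdorff convergence of the sets `F l` to `E` as `l → 0⁺`, with respect to the
homogeneous distance `D`. -/
def LocHausConv (D : HomDist n) (F : ℝ → Set (Hpt n)) (E : Set (Hpt n)) : Prop :=
  ∀ (c : Hpt n) (R ε : ℝ), 0 < R → 0 < ε → ∃ l0 : ℝ, 0 < l0 ∧ ∀ l : ℝ, 0 < l → l < l0 →
    (∀ x ∈ F l ∩ {q | D.d c q ≤ R}, ∃ e ∈ E, D.d x e < ε) ∧
    (∀ x ∈ E ∩ {q | D.d c q ≤ R}, ∃ y ∈ F l, D.d x y < ε)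

/-! ## Induced orientation on the boundary -/

/-- `tB` is the value at `p ∈ ∂S` of the orientation induced on `∂S` by the orientation `tS`
of the `m`-dimensional submanifold with boundary `S`. -/
def InducedBdryOrientAt (D : HomDist n) (m : ℕ) (S : Set (Hpt n)) (p : Hpt n)
    (tS : MVec n m) (tB : MVec n (m-1)) : Prop :=
  if m ≤ n then
    -- low dimension: classical Euclidean induced orientation via the outward normal
    ∃ (νc : Fin (2*n+1) → ℝ) (w : Fin (m-1) → (Fin (2*n+1) → ℝ)) (h : (m-1)+1 = m),
      (∀ i j : Fin ((m-1)+1), dotC (Matrix.vecCons νc w i) (Matrix.vecCons νc w j) = if i = j then 1 else 0) ∧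
      rE νc ∉ tangentConeAt ℝ (closure S) p ∧
      -(rE νc) ∈ tangentConeAt ℝ (closure S) p ∧
      (∀ i, rE (w i) ∈ tangentConeAt ℝ (bdry S) p) ∧
      tB = simpleWedge w ∧ tS = mvCast h (simpleWedge (Matrix.vecCons νc w))
  else if m = n+1 then
    -- critical codimension: `±T ∧ τ_{∂S} = t^ℍ_S` according to whether `S` lies below/above ∂S
    ∃ (U : Set (Hpt n)) (f : Fin n → Hpt n → ℝ), IsOpen U ∧ p ∈ U ∧
      (∀ i, IsC1H U (f i)) ∧ (∀ q ∈ U, LinearIndependent ℝ (fun i => gradH (f i) q)) ∧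
      U ∩ closure S ⊆ {q ∈ U | ∀ i, f i q = 0} ∧
      (∀ r : ℝ, 0 < r →
        (hball D p r ∩ ({q ∈ U | ∀ i, f i q = 0} \ closure S)).Nonempty) ∧
      ∃ (ε : ℝ) (w : Fin (m-1) → (Fin (2*n+1) → ℝ)) (h : (m-1)+1 = m),
        (ε = 1 ∨ ε = -1) ∧
        (∀ i j, dotC (w i) (w j) = if i = j then 1 else 0) ∧
        (∀ i, w i ⟨2*n, by omega⟩ = 0) ∧
        (∀ i, rF (w i) p ∈ tangentConeAt ℝ (bdry S) p) ∧
        -- `ε = −1` iff `S` lies above its boundary around `p`: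
        -- the blow-up of `S` at `p` is the corresponding open half of `T^ℍ_pS`
        LocHausConv D (fun l => (fun q => hdil l⁻¹ (hmul (hinv p) q)) '' S)
          ({v | ∀ i, pansuD (f i) p v = 0} ∩ {q | 0 < (-ε) * q.2.2}) ∧
        tB = simpleWedge (fun i => toEc (rF (w i) p)) ∧
        tS = mvCast h (simpleWedge (Matrix.vecCons (fun j => if (j:ℕ) = 2*n then ε else 0) w))
  else
    -- non-critical low codimension: `ν_{∂S} ∧ t^ℍ_{∂S} = t^ℍ_S` with `ν` the outward normal
    ∃ (U : Set (Hpt n)) (f : Fin (2*n+1-m+1) → Hpt n → ℝ),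
      IsBdryFrame (2*n+1-m) S p U f ∧
      ∃ (νc : Fin (2*n+1) → ℝ) (w : Fin (m-1) → (Fin (2*n+1) → ℝ)) (h : (m-1)+1 = m),
        (∀ i j : Fin ((m-1)+1), dotC (Matrix.vecCons νc w i) (Matrix.vecCons νc w j) = if i = j then 1 else 0) ∧
        (∀ i : Fin (2*n+1-m), pansuD (f i.castSucc) p (rE νc) = 0) ∧
        pansuD (f (Fin.last (2*n+1-m))) p (rE νc) < 0 ∧
        (∀ i, ∀ l : Fin (2*n+1-m+1), pansuD (f l) p (rE (w i)) = 0) ∧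
        tB = simpleWedge w ∧ tS = mvCast h (simpleWedge (Matrix.vecCons νc w))

/-! ## Miscellaneous -/

/-- The projection `π_p(q) = Σⱼ xⱼXⱼ(p) + Σⱼ yⱼYⱼ(p) ∈ H_pℍⁿ`. -/
def piProj (p q : Hpt n) : Hpt n :=
  (∑ j : Fin n, q.1 j • frameVec ⟨(j:ℕ), by omega⟩ p) +
  (∑ j : Fin n, q.2.1 j • frameVec ⟨n + (j:ℕ), by omega⟩ p)

/-- The norm `|·|_p` on the horizontal fibre `H_pℍⁿ` making `X₁(p),…,Yₙ(p)` orthonormal. -/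
def hnormAt (_p : Hpt n) (v : Hpt n) : ℝ :=
  Real.sqrt (∑ j, ((v.1 j) ^ 2 + (v.2.1 j) ^ 2))

/-- The left-invariant scalar product making `X₁,…,Yₙ,T` orthonormal. -/
def dotH (v w : Hpt n) : ℝ :=
  (∑ j, v.1 j * w.1 j) + (∑ j, v.2.1 j * w.2.1 j) + v.2.2 * w.2.2
/-! ## Proof of the blow-up theorem -/

lemma hmul_assoc' (p q r : Hpt n) : hmul (hmul p q) r = hmul p (hmul q r) := by
  refine Prod.ext ?_ (Prod.ext ?_ ?_)
  · simp [hmul, add_assoc]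
  · simp [hmul, add_assoc]
  · simp [hmul, add_mul, mul_add, Finset.sum_add_distrib]; ring

lemma hmul_zero' (p : Hpt n) : hmul p 0 = p := by
  refine Prod.ext ?_ (Prod.ext ?_ ?_) <;> simp [hmul]

lemma zero_hmul' (p : Hpt n) : hmul 0 p = p := by
  refine Prod.ext ?_ (Prod.ext ?_ ?_) <;> simp [hmul]

lemma hinv_hmul' (p : Hpt n) : hmul (hinv p) p = 0 := by
  refine Prod.ext ?_ (Prod.ext ?_ ?_)
  · simp [hmul, hinv]
  · simp [hmul, hinv]
  · simp [hmul, hinv]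

lemma hmul_hinv' (p : Hpt n) : hmul p (hinv p) = 0 := by
  refine Prod.ext ?_ (Prod.ext ?_ ?_)
  · simp [hmul, hinv]
  · simp [hmul, hinv]
  · simp [hmul, hinv]

lemma hmul_hinv_cancel (p q : Hpt n) : hmul p (hmul (hinv p) q) = q := by
  rw [← hmul_assoc', hmul_hinv', zero_hmul']

lemma hinv_hmul_cancel (p q : Hpt n) : hmul (hinv p) (hmul p q) = q := by
  rw [← hmul_assoc', hinv_hmul', zero_hmul']

lemma hdil_hdil (a b : ℝ) (p : Hpt n) : hdil a (hdil b p) = hdil (a * b) p := by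
  refine Prod.ext ?_ (Prod.ext ?_ ?_)
  · simp [hdil, mul_smul]
  · simp [hdil, mul_smul]
  · simp [hdil]; ring

lemma hdil_one (p : Hpt n) : hdil 1 p = p := by
  refine Prod.ext ?_ (Prod.ext ?_ ?_) <;> simp [hdil]

lemma hdil_zero' (a : ℝ) : hdil a (0 : Hpt n) = 0 := by
  refine Prod.ext ?_ (Prod.ext ?_ ?_) <;> simp [hdil]

lemma hdil_inv_hdil {l : ℝ} (hl : 0 < l) (p : Hpt n) : hdil l⁻¹ (hdil l p) = p := by
  rw [hdil_hdil, inv_mul_cancel₀ hl.ne', hdil_one]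

lemma hdil_hdil_inv {l : ℝ} (hl : 0 < l) (p : Hpt n) : hdil l (hdil l⁻¹ p) = p := by
  rw [hdil_hdil, mul_inv_cancel₀ hl.ne', hdil_one]

lemma continuous_hmul (p : Hpt n) : Continuous (fun q => hmul p q) := by
  unfold hmul; fun_prop

lemma pansuD_hmul (f : Hpt n → ℝ) (p v w : Hpt n) :
    pansuD f p (hmul v w) = pansuD f p v + pansuD f p w := by
  simp only [pansuD, hmul, ← Finset.sum_add_distrib]
  refine Finset.sum_congr rfl fun j _ => ?_
  simp only [Pi.add_apply]; ring

lemma pansuD_zero (f : Hpt n → ℝ) (p : Hpt n) : pansuD f p 0 = 0 := by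
  simp [pansuD]

lemma pansuD_hdil (f : Hpt n → ℝ) (p : Hpt n) (l : ℝ) (v : Hpt n) :
    pansuD f p (hdil l v) = l * pansuD f p v := by
  simp only [pansuD, hdil, Finset.mul_sum]
  refine Finset.sum_congr rfl fun j _ => ?_
  simp only [Pi.smul_apply, smul_eq_mul]; ring

lemma continuous_pansuD (f : Hpt n → ℝ) (p : Hpt n) : Continuous (pansuD f p) := by
  unfold pansuD; fun_prop

namespace HomDist

variable (D : HomDist n)

lemma self (p : Hpt n) : D.d p p = 0 := (D.eq_iff p p).2 rfl

lemma nonneg (p q : Hpt n) : 0 ≤ D.d p q := by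
  have h := D.triangle p q p
  rw [D.self, D.symm q p] at h; linarith

lemma d_hmul_right (q v : Hpt n) : D.d q (hmul q v) = D.d 0 v := by
  have := D.leftInv q 0 v
  rwa [hmul_zero'] at this

lemma d_eq (p q : Hpt n) : D.d p q = D.d 0 (hmul (hinv p) q) := by
  rw [← D.d_hmul_right p, hmul_hinv_cancel]

lemma N_hdil {l : ℝ} (hl : 0 < l) (v : Hpt n) : D.d 0 (hdil l v) = l * D.d 0 v := by
  have := D.homog l hl 0 v
  rwa [hdil_zero'] at this

lemma N_hmul (v w : Hpt n) : D.d 0 (hmul v w) ≤ D.d 0 v + D.d 0 w := by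
  have := D.triangle 0 v (hmul v w)
  rwa [D.d_hmul_right] at this

end HomDist

/-- Elementary horizontal steps. -/
def ev : Fin n ⊕ Fin n → ℝ → Hpt n
  | Sum.inl i, a => (Pi.single i a, 0, 0)
  | Sum.inr i, a => (0, Pi.single i a, 0)

/-- The corresponding horizontal derivative. -/
def gradE (f : Hpt n → ℝ) (p : Hpt n) : Fin n ⊕ Fin n → ℝ
  | Sum.inl i => gradH f p ⟨(i:ℕ), by omega⟩
  | Sum.inr i => gradH f p ⟨n + (i:ℕ), by omega⟩

lemma pansuD_ev (f : Hpt n → ℝ) (p : Hpt n) (j : Fin n ⊕ Fin n) (a : ℝ) :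
    pansuD f p (ev j a) = a * gradE f p j := by
  rcases j with i | i
  · simp only [pansuD, ev, gradE]
    rw [Finset.sum_eq_single i]
    · simp
    · intro b _ hb; simp [hb]
    · simp
  · simp only [pansuD, ev, gradE]
    rw [Finset.sum_eq_single i]
    · simp
    · intro b _ hb; simp [hb]
    · simp

/-- `v` is a product of elementary horizontal steps of total length `ℓ`. -/
inductive Word : Hpt n → ℝ → Prop
  | nil : Word 0 0
  | snoc (v : Hpt n) (l : ℝ) (j : Fin n ⊕ Fin n) (a : ℝ) (h : Word v l) :
      Word (hmul v (ev j a)) (l + |a|)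

lemma Word.nonneg {v : Hpt n} {l : ℝ} (h : Word v l) : 0 ≤ l := by
  induction h with
  | nil => exact le_rfl
  | snoc v l j a _ ih => positivity

lemma Word.mul {v w : Hpt n} {l m : ℝ} (hv : Word v l) (hw : Word w m) :
    Word (hmul v w) (l + m) := by
  induction hw with
  | nil => simpa [hmul_zero'] using hv
  | snoc w m j a _ ih =>
    rw [← hmul_assoc', ← add_assoc]
    exact Word.snoc _ _ j a ih

lemma Word.single (j : Fin n ⊕ Fin n) (a : ℝ) : Word (ev j a) |a| := by
  have := Word.snoc 0 0 j a Word.nil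
  rwa [zero_hmul', zero_add] at this

lemma word_x (x : Fin n → ℝ) : Word ((x, 0, 0) : Hpt n) (∑ i, |x i|) := by
  have key : ∀ s : Finset (Fin n),
      Word ((fun i => if i ∈ s then x i else 0, 0, 0) : Hpt n) (∑ i ∈ s, |x i|) := by
    intro s
    induction s using Finset.induction_on with
    | empty =>
      simp only [Finset.notMem_empty, if_false, Finset.sum_empty]
      exact Word.nil
    | insert a s ha ih =>
      have := ih.mul (Word.single (Sum.inl a) (x a))
      rw [Finset.sum_insert ha, add_comm]
      convert this using 1
      refine Prod.ext ?_ (Prod.ext ?_ ?_)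
      · funext i
        by_cases h : i = a
        · subst h; simp [hmul, ev, ha]
        · simp [hmul, ev, h]
      · simp [hmul, ev]
      · simp [hmul, ev]
  simpa using key Finset.univ

lemma word_y (x : Fin n → ℝ) : Word ((0, x, 0) : Hpt n) (∑ i, |x i|) := by
  have key : ∀ s : Finset (Fin n),
      Word ((0, fun i => if i ∈ s then x i else 0, 0) : Hpt n) (∑ i ∈ s, |x i|) := by
    intro s
    induction s using Finset.induction_on with
    | empty =>
      simp only [Finset.notMem_empty, if_false, Finset.sum_empty]
      exact Word.nil
    | insert a s ha ih =>
      have := ih.mul (Word.single (Sum.inr a) (x a))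
      rw [Finset.sum_insert ha, add_comm]
      convert this using 1
      refine Prod.ext ?_ (Prod.ext ?_ ?_)
      · simp [hmul, ev]
      · funext i
        by_cases h : i = a
        · subst h; simp [hmul, ev, ha]
        · simp [hmul, ev, h]
      · simp [hmul, ev]
  simpa using key Finset.univ

lemma word_t (i : Fin n) (t : ℝ) : Word ((0, 0, t) : Hpt n) (4 * √|t|) := by
  have key : ∀ a b : ℝ, Word ((0, 0, a * b) : Hpt n) (|a| + |b| + |a| + |b|) := by
    intro a b
    have := (((Word.single (Sum.inl i) a).mul (Word.single (Sum.inr i) b)).mul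
      (Word.single (Sum.inl i) (-a))).mul (Word.single (Sum.inr i) (-b))
    rw [abs_neg, abs_neg] at this
    convert this using 1
    refine Prod.ext ?_ (Prod.ext ?_ ?_)
    · simp [hmul, ev]
      funext j; by_cases h : j = i
      · subst h; simp
      · simp [h]
    · simp [hmul, ev]
      funext j; by_cases h : j = i
      · subst h; simp
      · simp [h]
    · simp [hmul, ev, Pi.single_apply]
      ring
  rcases le_total 0 t with ht | ht
  · have := key (√t) (√t)
    rw [Real.mul_self_sqrt ht] at this
    rw [abs_of_nonneg ht]
    convert this using 1
    rw [abs_of_nonneg (Real.sqrt_nonneg _)]; ring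
  · have := key (-√(-t)) (√(-t))
    rw [neg_mul, Real.mul_self_sqrt (by linarith), neg_neg] at this
    rw [abs_of_nonpos ht]
    convert this using 1
    rw [abs_neg, abs_of_nonneg (Real.sqrt_nonneg _)]; ring

/-- A homogeneous gauge. -/
def gau (v : Hpt n) : ℝ :=
  (∑ i, |v.1 i|) + (∑ i, |v.2.1 i|) + 4 * √|v.2.2 - (∑ i, v.1 i * v.2.1 i) / 2|

lemma gau_nonneg (v : Hpt n) : 0 ≤ gau v := by unfold gau; positivity

lemma word_gau (hn : 1 ≤ n) (v : Hpt n) : Word v (gau v) := by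
  have := ((word_x v.1).mul (word_y v.2.1)).mul
    (word_t ⟨0, hn⟩ (v.2.2 - (∑ i, v.1 i * v.2.1 i) / 2))
  unfold gau
  convert this using 1
  refine Prod.ext ?_ (Prod.ext ?_ ?_) <;> simp [hmul]

lemma continuous_gau : Continuous (gau : Hpt n → ℝ) := by
  unfold gau; fun_prop

lemma gau_zero : gau (0 : Hpt n) = 0 := by simp [gau]

lemma gau_hdil {l : ℝ} (hl : 0 < l) (v : Hpt n) : gau (hdil l v) = l * gau v := by
  have h : l ^ 2 * v.2.2 - (∑ i, l * v.1 i * (l * v.2.1 i)) / 2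
      = l ^ 2 * (v.2.2 - (∑ i, v.1 i * v.2.1 i) / 2) := by
    have : ∀ i, l * v.1 i * (l * v.2.1 i) = l ^ 2 * (v.1 i * v.2.1 i) := fun i => by ring
    simp only [this, ← Finset.mul_sum]; ring
  simp only [gau, hdil, Pi.smul_apply, smul_eq_mul, abs_mul, abs_of_pos hl, ← Finset.mul_sum]
  rw [h, abs_mul, abs_of_pos (by positivity : 0 < l ^ 2), Real.sqrt_mul (by positivity),
    Real.sqrt_sq hl.le]
  ring

lemma gau_bounds {v : Hpt n} {r : ℝ} (h : gau v ≤ r) :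
    (∀ i, |v.1 i| ≤ r) ∧ (∀ i, |v.2.1 i| ≤ r) ∧ |v.2.2| ≤ r ^ 2 + n * r ^ 2 := by
  have h1 : ∀ i, |v.1 i| ≤ ∑ i, |v.1 i| := fun i =>
    Finset.single_le_sum (f := fun i => |v.1 i|) (fun _ _ => abs_nonneg _) (Finset.mem_univ i)
  have h2 : ∀ i, |v.2.1 i| ≤ ∑ i, |v.2.1 i| := fun i =>
    Finset.single_le_sum (f := fun i => |v.2.1 i|) (fun _ _ => abs_nonneg _) (Finset.mem_univ i)
  have h3 : 0 ≤ ∑ i, |v.1 i| := by positivity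
  have h4 : 0 ≤ ∑ i, |v.2.1 i| := by positivity
  have h5 := Real.sqrt_nonneg |v.2.2 - (∑ i, v.1 i * v.2.1 i) / 2|
  unfold gau at h
  have a1 : ∀ i, |v.1 i| ≤ r := fun i => by linarith [h1 i]
  have a2 : ∀ i, |v.2.1 i| ≤ r := fun i => by linarith [h2 i]
  refine ⟨a1, a2, ?_⟩
  have h6 : √|v.2.2 - (∑ i, v.1 i * v.2.1 i) / 2| ≤ r := by linarith
  have h7 : |v.2.2 - (∑ i, v.1 i * v.2.1 i) / 2| ≤ r ^ 2 := by
    rw [← Real.sq_sqrt (abs_nonneg (v.2.2 - (∑ i, v.1 i * v.2.1 i) / 2))]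
    gcongr
  have h8 : |∑ i, v.1 i * v.2.1 i| ≤ n * r ^ 2 := by
    refine (Finset.abs_sum_le_sum_abs _ _).trans ?_
    have : ∀ i ∈ (Finset.univ : Finset (Fin n)), |v.1 i * v.2.1 i| ≤ r ^ 2 := by
      intro i _
      rw [abs_mul, sq]
      exact mul_le_mul (a1 i) (a2 i) (abs_nonneg _) ((abs_nonneg _).trans (a1 i))
    simpa using Finset.sum_le_card_nsmul _ _ _ this
  rw [abs_le] at h7 h8 ⊢
  have : 0 ≤ (n:ℝ) * r ^ 2 := by positivity
  constructor <;> linarith [h7.1, h7.2, h8.1, h8.2]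

lemma isCompact_gau (r : ℝ) : IsCompact {v : Hpt n | gau v ≤ r} := by
  refine Metric.isCompact_of_isClosed_isBounded
    (isClosed_le continuous_gau continuous_const) ?_
  refine (Metric.isBounded_iff_subset_closedBall 0).2 ⟨|r| + (r ^ 2 + n * r ^ 2), ?_⟩
  intro v hv
  have hr : 0 ≤ r := (gau_nonneg v).trans hv
  obtain ⟨a, b, c⟩ := gau_bounds hv
  rw [mem_closedBall_zero_iff, abs_of_nonneg hr]
  have : 0 ≤ r ^ 2 + n * r ^ 2 := by positivity
  refine max_le ?_ (max_le ?_ ?_)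
  · exact (pi_norm_le_iff_of_nonneg (by positivity)).2 fun i => (a i).trans (by linarith)
  · exact (pi_norm_le_iff_of_nonneg (by positivity)).2 fun i => (b i).trans (by linarith)
  · exact c.trans (by linarith)

lemma gau_eq_zero {v : Hpt n} (h : gau v = 0) : v = 0 := by
  obtain ⟨a, b, c⟩ := gau_bounds h.le
  refine Prod.ext ?_ (Prod.ext ?_ ?_)
  · funext i; simpa using a i
  · funext i; simpa using b i
  · simpa using c

/-- The norm of a unit horizontal step. -/
lemma HomDist.exists_kappa (D : HomDist n) (hn : 1 ≤ n) :
    ∃ κ : ℝ, 0 < κ ∧ ∀ j a, D.d 0 (ev j a) = |a| * κ := by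
  refine ⟨D.d 0 (ev (Sum.inl ⟨0, hn⟩) 1), ?_, ?_⟩
  · refine lt_of_le_of_ne (D.nonneg _ _) fun h => ?_
    have := (D.eq_iff _ _).1 h.symm
    have := congrArg (fun q : Hpt n => q.1 ⟨0, hn⟩) this
    simp [ev] at this
  · intro j a
    rcases eq_or_ne a 0 with rfl | ha
    · have : ev j 0 = (0 : Hpt n) := by rcases j with i | i <;> simp [ev]
      rw [this, D.self]; simp
    · rw [← D.N_hdil (abs_pos.2 ha)]
      apply D.rotInv
      · rcases j with i | i <;> simp [ev, hdil, Pi.single_apply]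
      · rcases j with i | i <;> simp [ev, hdil]

lemma Word.N_le {D : HomDist n} {κ : ℝ} (hκ : ∀ j a, D.d 0 (ev j a) = |a| * κ)
    {v : Hpt n} {l : ℝ} (h : Word v l) : D.d 0 v ≤ κ * l := by
  induction h with
  | nil => simp [D.self]
  | snoc v l j a _ ih =>
    refine (D.N_hmul _ _).trans ?_
    rw [hκ]; linarith

lemma HomDist.continuous_d (D : HomDist n) (hn : 1 ≤ n) (p : Hpt n) : Continuous (D.d p) := by
  obtain ⟨κ, hκ0, hκ⟩ := D.exists_kappa hn
  rw [continuous_iff_continuousAt]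
  intro q
  have h1 : Tendsto (fun q' => κ * gau (hmul (hinv q) q')) (𝓝 q) (𝓝 0) := by
    have : Continuous (fun q' => κ * gau (hmul (hinv q) q')) :=
      continuous_const.mul (continuous_gau.comp (continuous_hmul _))
    have h := this.tendsto q
    simpa [hinv_hmul', gau_zero] using h
  rw [ContinuousAt, tendsto_iff_dist_tendsto_zero]
  refine squeeze_zero (fun _ => dist_nonneg) (fun q' => ?_) h1
  have h2 : D.d q q' ≤ κ * gau (hmul (hinv q) q') := by
    rw [D.d_eq]; exact (word_gau hn _).N_le hκ
  have h3 := D.triangle p q q'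
  have h4 := D.triangle p q' q
  rw [D.symm q' q] at h4
  rw [Real.dist_eq, abs_le]
  constructor <;> linarith

lemma HomDist.exists_gau_le (D : HomDist n) (hn : 1 ≤ n) :
    ∃ A : ℝ, 0 < A ∧ ∀ v, gau v ≤ A * D.d 0 v := by
  have hK : IsCompact {v : Hpt n | gau v = 1} :=
    (isCompact_gau 1).of_isClosed_subset (isClosed_eq continuous_gau continuous_const)
      (fun v hv => le_of_eq hv)
  obtain ⟨m, hm, hmin⟩ := hK.exists_forall_le' (D.continuous_d hn 0).continuousOn (a := 0)
    (fun v hv => by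
      refine lt_of_le_of_ne (D.nonneg _ _) fun h => ?_
      have h0 := (D.eq_iff _ _).1 h.symm
      have h1 : gau v = 1 := hv
      rw [← h0, gau_zero] at h1
      exact zero_ne_one h1)
  refine ⟨m⁻¹, inv_pos.2 hm, fun v => ?_⟩
  rcases (gau_nonneg v).eq_or_lt with h | h
  · rw [← h]; exact mul_nonneg (inv_pos.2 hm).le (D.nonneg _ _)
  · have h1 := hmin (hdil (gau v)⁻¹ v) (by
      show gau _ = 1
      rw [gau_hdil (inv_pos.2 h), inv_mul_cancel₀ h.ne'])
    rw [D.N_hdil (inv_pos.2 h)] at h1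
    rw [inv_mul_eq_div, le_div_iff₀ hm]
    rw [inv_mul_eq_div, le_div_iff₀ h] at h1
    linarith

lemma HomDist.isCompact_ball (D : HomDist n) (hn : 1 ≤ n) (p : Hpt n) (R : ℝ) :
    IsCompact {q | D.d p q ≤ R} := by
  obtain ⟨A, hA, h⟩ := D.exists_gau_le hn
  refine ((isCompact_gau (A * R)).image (continuous_hmul p)).of_isClosed_subset
    (isClosed_le (D.continuous_d hn p) continuous_const) ?_
  intro q hq
  refine ⟨hmul (hinv p) q, ?_, hmul_hinv_cancel p q⟩
  refine (h _).trans ?_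
  rw [← D.d_eq]
  exact mul_le_mul_of_nonneg_left hq hA.le

lemma HomDist.exists_ball (D : HomDist n) (hn : 1 ≤ n) (p : Hpt n) {V : Set (Hpt n)}
    (hV : V ∈ 𝓝 p) : ∃ r > 0, ∀ q, D.d p q < r → q ∈ V := by
  obtain ⟨V', hV', hVo, hpV⟩ := mem_nhds_iff.1 hV
  have hK : IsCompact ({q | D.d p q ≤ 1} ∩ V'ᶜ) :=
    (D.isCompact_ball hn p 1).inter_right hVo.isClosed_compl
  obtain ⟨m, hm, hmin⟩ := hK.exists_forall_le' (D.continuous_d hn p).continuousOn (a := 0)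
    (fun v hv => by
      refine lt_of_le_of_ne (D.nonneg _ _) fun h => ?_
      have h0 := (D.eq_iff _ _).1 h.symm
      exact hv.2 (h0 ▸ hpV))
  refine ⟨min m 1, lt_min hm one_pos, fun q hq => ?_⟩
  by_contra hqV
  have := hmin q ⟨(hq.trans_le (min_le_right _ _)).le, fun h => hqV (hV' h)⟩
  linarith [min_le_left m 1]

lemma hasDerivAt_ev {U : Set (Hpt n)} {f : Hpt n → ℝ} (hf : IsC1H U f) (q : Hpt n)
    (j : Fin n ⊕ Fin n) (s : ℝ) (hs : hmul q (ev j s) ∈ U) :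
    HasDerivAt (fun t => f (hmul q (ev j t))) (gradE f (hmul q (ev j s)) j) s := by
  have main : ∀ (j' : Fin (2*n)),
      (∀ t : ℝ, hmul q (ev j s) + t • frameVec (hIdx j') (hmul q (ev j s))
        = hmul q (ev j (s + t))) →
      HasDerivAt (fun t => f (hmul q (ev j t))) (gradH f (hmul q (ev j s)) j') s := by
    intro j' hj'
    have h := (hf.ldiff _ hs j').hasLineDerivAt
    have h2 : HasDerivAt (fun t => f (hmul q (ev j (s + t))))
        (gradH f (hmul q (ev j s)) j') 0 := by
      have h3 := h
      unfold HasLineDerivAt at h3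
      simp only [hj'] at h3
      exact h3
    have h4 : HasDerivAt (fun t => f (hmul q (ev j (s + t))))
        (gradH f (hmul q (ev j s)) j') (s - s) := by rwa [sub_self]
    have h5 := h4.comp_sub_const s s
    simpa using h5
  rcases j with i | i
  · refine main ⟨(i:ℕ), by omega⟩ fun t => ?_
    have hi : ((hIdx (⟨(i:ℕ), by omega⟩ : Fin (2*n)) : Fin (2*n+1)) : ℕ) = i := rfl
    rw [frameVec, dif_pos (by rw [hi]; exact i.2)]
    refine Prod.ext ?_ (Prod.ext ?_ ?_)
    · simp only [hmul, ev, Prod.fst_add, Prod.smul_fst]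
      funext k
      by_cases hk : k = i
      · subst hk; simp [hIdx]; ring
      · simp [hIdx, hk]
    · simp [hmul, ev]
    · simp [hmul, ev, hIdx, Pi.single_apply]; ring
  · refine main ⟨n + (i:ℕ), by omega⟩ fun t => ?_
    have hi : ((hIdx (⟨n + (i:ℕ), by omega⟩ : Fin (2*n)) : Fin (2*n+1)) : ℕ) = n + i := rfl
    have hi2 : (n + (i:ℕ)) < 2 * n := by omega
    rw [frameVec, dif_neg (by rw [hi]; omega), dif_pos (by rw [hi]; exact hi2)]
    refine Prod.ext ?_ (Prod.ext ?_ ?_)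
    · simp [hmul, ev]
    · simp only [hmul, ev, Prod.fst_add, Prod.smul_fst, Prod.snd_add, Prod.smul_snd]
      funext k
      by_cases hk : k = i
      · subst hk; simp [hIdx]; ring
      · simp [hIdx, hk]
    · simp [hmul, ev, hIdx, Pi.single_apply]; ring

lemma step_estimate {U : Set (Hpt n)} {f : Hpt n → ℝ} (hf : IsC1H U f)
    {D : HomDist n} {κ : ℝ} (hκ0 : 0 < κ) (hκ : ∀ j a, D.d 0 (ev j a) = |a| * κ)
    {p : Hpt n} {r η : ℝ}
    (hr : ∀ q, D.d p q < r → q ∈ U ∧ ∀ j, |gradE f q j - gradE f p j| ≤ η)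
    (q : Hpt n) (j : Fin n ⊕ Fin n) (a : ℝ) (h : D.d p q + κ * |a| < r) :
    |f (hmul q (ev j a)) - f q - a * gradE f p j| ≤ η * |a| := by
  have hin : ∀ s ∈ uIcc 0 a, D.d p (hmul q (ev j s)) < r := by
    intro s hs
    have h1 : |s| ≤ |a| := by simpa using abs_sub_left_of_mem_uIcc hs
    have h2 := D.triangle p q (hmul q (ev j s))
    rw [D.d_hmul_right, hκ] at h2
    have : |s| * κ ≤ |a| * κ := by gcongr
    linarith
  have hd : ∀ s ∈ uIcc 0 a, HasDerivWithinAt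
      (fun t => f (hmul q (ev j t)) - t * gradE f p j)
      (gradE f (hmul q (ev j s)) j - gradE f p j) (uIcc 0 a) s := by
    intro s hs
    have h1 := hasDerivAt_ev hf q j s (hr _ (hin s hs)).1
    have h2 : HasDerivAt (fun t : ℝ => t * gradE f p j) (gradE f p j) s := by
      simpa using (hasDerivAt_id s).mul_const (gradE f p j)
    exact (h1.sub h2).hasDerivWithinAt
  have hb : ∀ s ∈ uIcc 0 a, ‖gradE f (hmul q (ev j s)) j - gradE f p j‖ ≤ η :=
    fun s hs => (hr _ (hin s hs)).2 j
  have := (convex_uIcc (0:ℝ) a).norm_image_sub_le_of_norm_hasDerivWithin_le hd hb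
    left_mem_uIcc right_mem_uIcc
  have h0 : ev j 0 = (0 : Hpt n) := by rcases j with i | i <;> simp [ev]
  simp only [h0, hmul_zero', zero_mul, sub_zero, Real.norm_eq_abs] at this
  convert this using 2
  ring

lemma word_estimate {U : Set (Hpt n)} {f : Hpt n → ℝ} (hf : IsC1H U f)
    {D : HomDist n} {κ : ℝ} (hκ0 : 0 < κ) (hκ : ∀ j a, D.d 0 (ev j a) = |a| * κ)
    {p : Hpt n} {r η : ℝ}
    (hr : ∀ q, D.d p q < r → q ∈ U ∧ ∀ j, |gradE f q j - gradE f p j| ≤ η)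
    (q : Hpt n) {v : Hpt n} {l : ℝ} (hv : Word v l) (h : D.d p q + κ * l < r) :
    |f (hmul q v) - f q - pansuD f p v| ≤ η * l := by
  induction hv with
  | nil => simp [hmul_zero', pansuD_zero]
  | snoc v l j a hw ih =>
    have ha : 0 ≤ κ * |a| := by positivity
    have ih' := ih (by linarith)
    have h1 := D.triangle p q (hmul q v)
    rw [D.d_hmul_right] at h1
    have h2 := hw.N_le hκ
    have h3 := step_estimate hf hκ0 hκ hr (hmul q v) j a (by linarith)
    rw [← hmul_assoc', pansuD_hmul, pansuD_ev]
    rw [abs_le] at ih' h3 ⊢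
    constructor <;> linarith [ih'.1, ih'.2, h3.1, h3.2]

/-- Uniform increment estimate. -/
lemma increment (hn : 1 ≤ n) (D : HomDist n) {κ : ℝ} (hκ0 : 0 < κ)
    (hκ : ∀ j a, D.d 0 (ev j a) = |a| * κ) {m : ℕ} {U : Set (Hpt n)} (hU : IsOpen U)
    {p : Hpt n} (hp : p ∈ U) {f : Fin m → Hpt n → ℝ} (hf : ∀ i, IsC1H U (f i))
    {η : ℝ} (hη : 0 < η) :
    ∃ r > 0, (∀ q, D.d p q < r → q ∈ U) ∧ ∀ q v, D.d p q + κ * gau v < r →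
      ∀ i, |f i (hmul q v) - f i q - pansuD (f i) p v| ≤ η * gau v := by
  have hg : ∀ i (j : Fin n ⊕ Fin n), ∀ᶠ q in 𝓝 p, |gradE (f i) q j - gradE (f i) p j| ≤ η := by
    intro i j
    have hc : ContinuousAt (fun q => gradE (f i) q j) p := by
      rcases j with j | j
      · exact ((hf i).contGrad _).continuousAt (hU.mem_nhds hp)
      · exact ((hf i).contGrad _).continuousAt (hU.mem_nhds hp)
    filter_upwards [Metric.tendsto_nhds.1 hc η hη] with q hq
    exact (Real.dist_eq _ _ ▸ hq).le
  have hall : ∀ᶠ q in 𝓝 p, q ∈ U ∧ ∀ i j, |gradE (f i) q j - gradE (f i) p j| ≤ η :=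
    Filter.Eventually.and (hU.mem_nhds hp) (eventually_all.2 fun i => eventually_all.2 fun j => hg i j)
  obtain ⟨r, hr0, hr⟩ := D.exists_ball hn p hall
  refine ⟨r, hr0, fun q hq => (hr q hq).1, fun q v h i => ?_⟩
  exact word_estimate (hf i) hκ0 hκ (fun q hq => ⟨(hr q hq).1, (hr q hq).2 i⟩) q
    (word_gau hn v) h

/-- A bounded right inverse of the Pansu differential. -/
lemma exists_right_inv {m : ℕ} {p : Hpt n} {f : Fin m → Hpt n → ℝ}
    (hli : LinearIndependent ℝ (fun i => gradH (f i) p)) :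
    ∃ (B : (Fin m → ℝ) → Hpt n) (C : ℝ), 0 < C ∧
      (∀ c i, pansuD (f i) p (B c) = c i) ∧ ∀ c, gau (B c) ≤ C * ‖c‖ := by
  let M : Matrix (Fin m) (Fin (2*n)) ℝ := Matrix.of fun i => gradH (f i) p
  have hrank : M.rank = m := by
    have : LinearIndependent ℝ M.row := hli
    simpa using this.rank_matrix
  have hsurj : LinearMap.range M.mulVecLin = ⊤ := by
    apply Submodule.eq_top_of_finrank_eq
    rw [← Matrix.rank, hrank]; simp
  obtain ⟨g, hg⟩ := M.mulVecLin.exists_rightInverse_of_surjective hsurj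
  let G := LinearMap.toContinuousLinearMap g
  let X : (Fin m → ℝ) → Fin n → ℝ := fun c i => g c ⟨(i:ℕ), by omega⟩
  let Y : (Fin m → ℝ) → Fin n → ℝ := fun c i => g c ⟨n + (i:ℕ), by omega⟩
  have hG : ∀ c j, |g c j| ≤ ‖G‖ * ‖c‖ := fun c j =>
    (norm_le_pi_norm (g c) j).trans (G.le_opNorm c)
  refine ⟨fun c => (X c, Y c, (∑ i, X c i * Y c i) / 2), n * ‖G‖ + n * ‖G‖ + 1, by positivity,
    fun c i => ?_, fun c => ?_⟩
  · have h1 : M.mulVecLin (g c) = c := LinearMap.congr_fun hg c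
    have h2 : ∑ j, gradH (f i) p j * g c j = c i := by
      have := congrFun h1 i
      simpa [Matrix.mulVec, dotProduct, M] using this
    rw [← h2]
    have h3 : ∑ j : Fin (2*n), gradH (f i) p j * g c j
        = ∑ j : Fin (n + n), gradH (f i) p (Fin.cast (by omega) j) * g c (Fin.cast (by omega) j) :=
      (Equiv.sum_comp (finCongr (by omega : n + n = 2 * n))
        (fun j => gradH (f i) p j * g c j)).symm
    rw [h3, Fin.sum_univ_add, ← Finset.sum_add_distrib]
    simp only [pansuD, X, Y]
    refine Finset.sum_congr rfl fun j _ => ?_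
    rw [mul_comm, mul_comm (g c ⟨n + (j:ℕ), _⟩)]
    rfl
  · have h1 : ∑ i, |X c i| ≤ n * (‖G‖ * ‖c‖) := by
      simpa using Finset.sum_le_card_nsmul Finset.univ (fun i => |X c i|) (‖G‖ * ‖c‖)
        (fun i _ => hG c _)
    have h2 : ∑ i, |Y c i| ≤ n * (‖G‖ * ‖c‖) := by
      simpa using Finset.sum_le_card_nsmul Finset.univ (fun i => |Y c i|) (‖G‖ * ‖c‖)
        (fun i _ => hG c _)
    simp only [gau, sub_self, abs_zero, Real.sqrt_zero, mul_zero, add_zero]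
    nlinarith [norm_nonneg c]

/-- Metric regularity of `f` near `p`. -/
lemma metric_regular (hn : 1 ≤ n) (D : HomDist n) {m : ℕ} {U : Set (Hpt n)} (hU : IsOpen U)
    {p : Hpt n} (hp : p ∈ U) {f : Fin m → Hpt n → ℝ} (hf : ∀ i, IsC1H U (f i))
    (hli : LinearIndependent ℝ (fun i => gradH (f i) p)) :
    ∃ r > 0, ∃ C > 0, ∀ q₀ c, D.d p q₀ < r → C * ‖(fun i => f i q₀) - c‖ < r →
      ∃ q ∈ U, D.d q₀ q ≤ C * ‖(fun i => f i q₀) - c‖ ∧ ∀ i, f i q = c i := by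
  obtain ⟨κ, hκ0, hκ⟩ := D.exists_kappa hn
  obtain ⟨B, C₂, hC₂, hB, hBn⟩ := exists_right_inv hli
  obtain ⟨r, hr0, hrU, hr⟩ := increment hn D hκ0 hκ hU hp hf (η := 1 / (4 * C₂)) (by positivity)
  refine ⟨r / 3, by positivity, 4 * κ * C₂, by positivity, fun q₀ c hq₀ hc => ?_⟩
  set e₀ := ‖(fun i => f i q₀) - c‖ with he₀
  set ρ := 4 * κ * C₂ * e₀ with hρ
  have he₀0 : 0 ≤ e₀ := norm_nonneg _
  have hρ0 : 0 ≤ ρ := by positivity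
  have hKU : ∀ q, D.d q₀ q ≤ ρ → D.d p q < 2 * r / 3 := by
    intro q hq
    have := D.triangle p q₀ q
    linarith
  have hcont : ContinuousOn (fun q => 4 * κ * C₂ * ‖(fun i => f i q) - c‖ + D.d q₀ q)
      {q | D.d q₀ q ≤ ρ} := by
    refine ContinuousOn.add (continuousOn_const.mul (ContinuousOn.norm
      (ContinuousOn.sub (continuousOn_pi.2 fun i => ?_) continuousOn_const)))
      (D.continuous_d hn q₀).continuousOn
    exact (hf i).contOn.mono fun q hq => hrU q ((hKU q hq).trans (by linarith))
  obtain ⟨q, hqK, hmin⟩ := (D.isCompact_ball hn q₀ ρ).exists_isMinOn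
    ⟨q₀, by simpa [D.self] using hρ0⟩ hcont
  have hqK' : D.d q₀ q ≤ ρ := hqK
  have hqU := hKU q hqK
  refine ⟨q, hrU q (by linarith), hqK, ?_⟩
  have hq0 := hmin (show q₀ ∈ {q | D.d q₀ q ≤ ρ} by simpa [D.self] using hρ0)
  simp only [mem_ofPred_eq, D.self, add_zero, ← he₀, ← hρ] at hq0
  by_contra hne
  set e : Fin m → ℝ := c - (fun i => f i q) with he
  have hen : ‖(fun i => f i q) - c‖ = ‖e‖ := by rw [he, norm_sub_rev]
  have he0 : 0 < ‖e‖ := by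
    rw [norm_pos_iff]
    intro h0
    apply hne
    intro i
    have := congrFun h0 i
    simp only [he, Pi.sub_apply, Pi.zero_apply] at this
    linarith
  rw [hen] at hq0
  have hBe := hBn e
  have hdw : κ * gau (B e) ≤ κ * C₂ * ‖e‖ := by
    rw [mul_assoc]; exact mul_le_mul_of_nonneg_left hBe hκ0.le
  have hd0 := D.nonneg q₀ q
  have hsmall : D.d p q + κ * gau (B e) < r := by linarith
  have hinc := hr q (B e) hsmall
  have hnew : ‖(fun i => f i (hmul q (B e))) - c‖ ≤ ‖e‖ / 4 := by
    refine (pi_norm_le_iff_of_nonneg (by positivity)).2 fun i => ?_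
    have h1 := hinc i
    rw [hB] at h1
    have h2 : 1 / (4 * C₂) * gau (B e) ≤ ‖e‖ / 4 := by
      calc 1 / (4 * C₂) * gau (B e) ≤ 1 / (4 * C₂) * (C₂ * ‖e‖) := by gcongr
        _ = ‖e‖ / 4 := by field_simp
    rw [Real.norm_eq_abs]
    refine le_trans (le_of_eq ?_) (h1.trans h2)
    congr 1
    simp only [he, Pi.sub_apply]; ring
  have hd : D.d q₀ (hmul q (B e)) ≤ D.d q₀ q + κ * C₂ * ‖e‖ := by
    have h1 := D.triangle q₀ q (hmul q (B e))
    rw [D.d_hmul_right] at h1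
    have h2 := (word_gau hn (B e)).N_le hκ
    linarith
  have hpos : 0 < κ * C₂ * ‖e‖ := by positivity
  have hnew' : 4 * κ * C₂ * ‖(fun i => f i (hmul q (B e))) - c‖ ≤ κ * C₂ * ‖e‖ := by
    calc _ ≤ 4 * κ * C₂ * (‖e‖ / 4) := by gcongr
      _ = _ := by ring
  have hmem : hmul q (B e) ∈ {q | D.d q₀ q ≤ ρ} := by
    simp only [mem_ofPred_eq]; linarith
  have := hmin hmem
  simp only [mem_ofPred_eq, hen] at this
  linarith

/-- Pansu differentiability. -/
lemma pansu_diff (hn : 1 ≤ n) (D : HomDist n) {m : ℕ} {U : Set (Hpt n)} (hU : IsOpen U)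
    {p : Hpt n} (hp : p ∈ U) {f : Fin m → Hpt n → ℝ} (hf : ∀ i, IsC1H U (f i))
    (hfp : ∀ i, f i p = 0) {η : ℝ} (hη : 0 < η) :
    ∃ r > 0, ∀ v, D.d 0 v < r → hmul p v ∈ U ∧
      ∀ i, |f i (hmul p v) - pansuD (f i) p v| ≤ η * D.d 0 v := by
  obtain ⟨κ, hκ0, hκ⟩ := D.exists_kappa hn
  obtain ⟨A, hA, hAv⟩ := D.exists_gau_le hn
  obtain ⟨r, hr0, hrU, hr⟩ := increment hn D hκ0 hκ hU hp hf (η := η / A) (by positivity)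
  refine ⟨min r (r / (κ * A)), by positivity, fun v hv => ⟨?_, fun i => ?_⟩⟩
  · apply hrU
    rw [D.d_hmul_right]
    exact hv.trans_le (min_le_left _ _)
  · have h1 : D.d 0 v < r / (κ * A) := hv.trans_le (min_le_right _ _)
    rw [lt_div_iff₀ (by positivity)] at h1
    have h2 : κ * gau v ≤ κ * (A * D.d 0 v) := mul_le_mul_of_nonneg_left (hAv v) hκ0.le
    have h3 := hr p v (by rw [D.self]; nlinarith) i
    rw [hfp, sub_zero] at h3
    refine h3.trans ?_
    calc η / A * gau v ≤ η / A * (A * D.d 0 v) := by gcongr; exact hAv v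
      _ = η * D.d 0 v := by field_simp

/-- Lifting of points of the blow-up to points with prescribed values of `f`. -/
lemma lift_point (hn : 1 ≤ n) (D : HomDist n) {m : ℕ} {U : Set (Hpt n)} (hU : IsOpen U)
    {p : Hpt n} (hp : p ∈ U) {f : Fin m → Hpt n → ℝ} (hf : ∀ i, IsC1H U (f i))
    (hli : LinearIndependent ℝ (fun i => gradH (f i) p)) (hfp : ∀ i, f i p = 0)
    {R ε : ℝ} (hR : 0 < R) (hε : 0 < ε) :
    ∃ l0 > 0, ∀ l, 0 < l → l < l0 → ∀ v, D.d 0 v ≤ R → ∃ q ∈ U,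
      (∀ i, f i q = l * pansuD (f i) p v) ∧ D.d v (hdil l⁻¹ (hmul (hinv p) q)) < ε := by
  obtain ⟨r, hr, C, hC, hreg⟩ := metric_regular hn D hU hp hf hli
  obtain ⟨r', hr', hpan⟩ := pansu_diff hn D hU hp hf hfp (η := ε / (2 * C * R)) (by positivity)
  refine ⟨min (r / R) (min (r' / R) (r / ε)), by positivity, fun l hl hl0 v hv => ?_⟩
  have h1 : l * R < r := (lt_div_iff₀ hR).1 (hl0.trans_le (min_le_left _ _))
  have h2 : l * R < r' := (lt_div_iff₀ hR).1
    (hl0.trans_le ((min_le_right _ _).trans (min_le_left _ _)))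
  have h3 : l * ε < r := (lt_div_iff₀ hε).1
    (hl0.trans_le ((min_le_right _ _).trans (min_le_right _ _)))
  have hN : D.d 0 (hdil l v) ≤ l * R := by
    rw [D.N_hdil hl]; exact mul_le_mul_of_nonneg_left hv hl.le
  obtain ⟨_, hinc⟩ := hpan (hdil l v) (by linarith)
  have hnorm : ‖(fun i => f i (hmul p (hdil l v))) - fun i => l * pansuD (f i) p v‖
      ≤ ε / (2 * C) * l := by
    refine (pi_norm_le_iff_of_nonneg (by positivity)).2 fun i => ?_
    have := hinc i
    rw [pansuD_hdil] at this
    refine this.trans ?_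
    calc ε / (2 * C * R) * D.d 0 (hdil l v) ≤ ε / (2 * C * R) * (l * R) := by gcongr
      _ = ε / (2 * C) * l := by field_simp
  have hCn : C * ‖(fun i => f i (hmul p (hdil l v))) - fun i => l * pansuD (f i) p v‖
      ≤ l * ε / 2 := by
    calc _ ≤ C * (ε / (2 * C) * l) := by gcongr
      _ = _ := by field_simp
  have hlε : 0 < l * ε := by positivity
  obtain ⟨q, hqU, hqd, hq⟩ := hreg (hmul p (hdil l v)) _
    (by rw [D.d_hmul_right]; linarith) (by linarith : _ < r)
  refine ⟨q, hqU, hq, ?_⟩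
  have h5 : D.d (hmul p (hdil l v)) q = l * D.d v (hdil l⁻¹ (hmul (hinv p) q)) := by
    rw [← D.homog l hl, hdil_hdil_inv hl, ← D.leftInv p (hdil l v), hmul_hinv_cancel]
  have h6 : l * D.d v (hdil l⁻¹ (hmul (hinv p) q)) < l * ε := by
    rw [← h5]; linarith
  exact lt_of_mul_lt_mul_left h6 hl.le

lemma forall_fin_succ_last {k : ℕ} {P : Fin (k+1) → Prop} (h : ∀ i : Fin k, P i.castSucc)
    (hl : P (Fin.last k)) : ∀ i, P i := fun i => Fin.lastCases hl h i

/-- **Blow-up of a submanifold with boundary at a boundary point** (from the proof of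
Lemma 3.10): if `1 ≤ k ≤ n−1`, `S` is a `k`-codimensional `C¹_ℍ`-regular submanifold with
boundary in `O`, `p ∈ O ∩ ∂S` and `f₁,…,f_{k+1}` are locally defining functions at `p`, then
`δ_{1/λ}(p⁻¹⬝S)` converges, in the sense of local Hausdorff convergence of sets, to
`T^ℍ_pS ∩ {(d_ℍf_{k+1})_p > 0}`, and `T^ℍ_p∂S = T^ℍ_pS ∩ {(d_ℍf_{k+1})_p = 0}`. -/
theorem boundary_blowup {n : ℕ} (hn : 1 ≤ n) (D : HomDist n)
    (k : ℕ) (hk1 : 1 ≤ k) (hk2 : k ≤ n - 1)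
    (O : Set (Hpt n)) (hO : IsOpen O) (S : Set (Hpt n)) (hSO : S ⊆ O)
    (hS : IsC1HSubWithBdry D k O S)
    (p : Hpt n) (hp : p ∈ O ∩ bdry S)
    (U : Set (Hpt n)) (f : Fin (k+1) → Hpt n → ℝ) (hf : IsBdryFrame k S p U f) :
    LocHausConv D (fun l => (fun q => hdil l⁻¹ (hmul (hinv p) q)) '' S)
      ({v | ∀ i : Fin k, pansuD (f i.castSucc) p v = 0} ∩
        {q | 0 < pansuD (f (Fin.last k)) p q}) ∧
    tangentConeHAt (bdry S) p =
      {v | ∀ i : Fin k, pansuD (f i.castSucc) p v = 0} ∩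
        {q | pansuD (f (Fin.last k)) p q = 0} := by
  obtain ⟨hU, hpU, hC1, hli, hSU, hlast⟩ := hf
  have hli' := hli p hpU
  have memS : ∀ q ∈ U, (q ∈ S ↔ (∀ i : Fin k, f i.castSucc q = 0) ∧ 0 < f (Fin.last k) q) := by
    intro q hq
    have : q ∈ U ∩ S ↔ q ∈ {q ∈ U | (∀ i : Fin k, f i.castSucc q = 0) ∧ 0 < f (Fin.last k) q} := by
      rw [hSU]
    constructor
    · intro h; exact (this.1 ⟨hq, h⟩).2
    · intro h; exact (this.2 ⟨hq, h⟩).2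
  have bdry_zero : ∀ q ∈ U, q ∈ bdry S → ∀ i, f i q = 0 := by
    intro q hq hqb
    have hcl : q ∈ closure (U ∩ S) := hU.inter_closure ⟨hq, hqb.1⟩
    have hne : (𝓝[U ∩ S] q).NeBot := mem_closure_iff_nhdsWithin_neBot.1 hcl
    have hten : ∀ i, Tendsto (f i) (𝓝[U ∩ S] q) (𝓝 (f i q)) := fun i =>
      (((hC1 i).contOn.continuousAt (hU.mem_nhds hq)).tendsto).mono_left nhdsWithin_le_nhds
    have h1 : ∀ i : Fin k, f i.castSucc q = 0 := by
      intro i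
      refine tendsto_nhds_unique (hten i.castSucc) (tendsto_const_nhds.congr' ?_)
      filter_upwards [self_mem_nhdsWithin] with x hx
      exact (((memS x hx.1).1 hx.2).1 i).symm
    have h2 : 0 ≤ f (Fin.last k) q := by
      refine ge_of_tendsto (hten (Fin.last k)) ?_
      filter_upwards [self_mem_nhdsWithin] with x hx
      exact ((memS x hx.1).1 hx.2).2.le
    have h3 : f (Fin.last k) q = 0 := by
      by_contra h
      exact hqb.2 ((memS q hq).2 ⟨h1, lt_of_le_of_ne h2 (Ne.symm h)⟩)
    exact forall_fin_succ_last h1 h3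
  have hfp : ∀ i, f i p = 0 := bdry_zero p hpU hp.2
  constructor
  · intro c R ε hR hε
    set R₀ := R + D.d 0 c with hR₀
    have hR₀0 : 0 < R₀ := by have := D.nonneg 0 c; positivity
    have hbd : ∀ x, D.d c x ≤ R → D.d 0 x ≤ R₀ := fun x hx => by
      have := D.triangle 0 c x; linarith
    obtain ⟨κ, hκ0, hκ⟩ := D.exists_kappa hn
    obtain ⟨B, C, hC, hB, hBn⟩ := exists_right_inv hli'
    obtain ⟨l₁, hl₁, hlift⟩ := lift_point hn D hU hpU hC1 hli' hfp hR₀0 hε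
    obtain ⟨r, hr, hpan⟩ := pansu_diff hn D hU hpU hC1 hfp (η := ε / (4 * κ * C * R₀))
      (by positivity)
    refine ⟨min l₁ (r / R₀), by positivity, fun l hl hl0 => ⟨?_, ?_⟩⟩
    · rintro x ⟨⟨q, hqS, rfl⟩, hxR⟩
      simp only at hxR ⊢
      set x := hdil l⁻¹ (hmul (hinv p) q) with hx
      have hxN : D.d 0 x ≤ R₀ := hbd x hxR
      have hq : q = hmul p (hdil l x) := by
        rw [hx, hdil_hdil_inv hl, hmul_hinv_cancel]
      have h1 : l * R₀ < r := (lt_div_iff₀ hR₀0).1 (hl0.trans_le (min_le_right _ _))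
      have hN : D.d 0 (hdil l x) ≤ l * R₀ := by
        rw [D.N_hdil hl]; exact mul_le_mul_of_nonneg_left hxN hl.le
      obtain ⟨hqU, hinc⟩ := hpan (hdil l x) (by linarith)
      rw [← hq] at hqU hinc
      obtain ⟨hz, hpos⟩ := (memS q hqU).1 hqS
      set δ := ε / (4 * κ * C) with hδ
      have hδ0 : 0 < δ := by positivity
      have hinc' : ∀ i, |f i q - l * pansuD (f i) p x| ≤ l * δ := by
        intro i
        have := hinc i
        rw [pansuD_hdil] at this
        refine this.trans ?_
        calc ε / (4 * κ * C * R₀) * D.d 0 (hdil l x) ≤ ε / (4 * κ * C * R₀) * (l * R₀) := by gcongr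
          _ = l * δ := by rw [hδ]; field_simp
      have hA : ∀ i : Fin k, |pansuD (f i.castSucc) p x| ≤ δ := by
        intro i
        have := hinc' i.castSucc
        rw [hz i, zero_sub, abs_neg, abs_mul, abs_of_pos hl] at this
        exact le_of_mul_le_mul_left this hl
      have hBl : -δ < pansuD (f (Fin.last k)) p x := by
        have := (abs_le.1 (hinc' (Fin.last k))).2
        have h2 : l * (-δ) < l * pansuD (f (Fin.last k)) p x := by linarith
        exact lt_of_mul_lt_mul_left h2 hl.le
      let τ : Fin (k+1) → ℝ := fun i =>
        (if i = Fin.last k then max (pansuD (f i) p x) 0 + δ else 0) - pansuD (f i) p x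
      have hτ : ‖τ‖ ≤ 2 * δ := by
        refine (pi_norm_le_iff_of_nonneg (by positivity)).2 ?_
        refine forall_fin_succ_last (fun i => ?_) ?_
        · have h0 : i.castSucc ≠ Fin.last k := (Fin.castSucc_lt_last i).ne
          simp only [τ, if_neg h0, zero_sub, Real.norm_eq_abs, abs_neg]
          linarith [hA i]
        · simp only [τ, if_true, Real.norm_eq_abs]
          rcases le_total (pansuD (f (Fin.last k)) p x) 0 with h | h
          · rw [max_eq_right h, abs_le]; constructor <;> linarith
          · rw [max_eq_left h, abs_le]; constructor <;> linarith
      refine ⟨hmul x (B τ), ⟨fun i => ?_, ?_⟩, ?_⟩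
      · have h0 : i.castSucc ≠ Fin.last k := (Fin.castSucc_lt_last i).ne
        rw [pansuD_hmul, hB]
        simp only [τ, if_neg h0]; ring
      · show 0 < pansuD _ _ _
        rw [pansuD_hmul, hB]
        simp only [τ, if_true]
        linarith [le_max_right (pansuD (f (Fin.last k)) p x) 0]
      · rw [D.d_hmul_right]
        have h2 := (word_gau hn (B τ)).N_le hκ
        have h3 : κ * gau (B τ) ≤ κ * (C * (2 * δ)) := by
          gcongr
          exact (hBn τ).trans (by gcongr)
        have h4 : κ * (C * (2 * δ)) = ε / 2 := by rw [hδ]; field_simp; norm_num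
        linarith
    · rintro x ⟨⟨hx0, hxpos⟩, hxR⟩
      obtain ⟨q, hqU, hq, hd⟩ := hlift l hl (hl0.trans_le (min_le_left _ _)) x (hbd x hxR)
      refine ⟨_, ⟨q, (memS q hqU).2 ⟨fun i => ?_, ?_⟩, rfl⟩, hd⟩
      · rw [hq, hx0 i, mul_zero]
      · rw [hq]; exact mul_pos hl hxpos
  · ext v
    constructor
    · rintro ⟨xh, rh, hxE, hrh, hlim⟩
      have hvan : ∀ i, pansuD (f i) p v = 0 := by
        intro i
        have hNlim : Tendsto (fun h => D.d 0 (hdil (rh h) (xh h))) atTop (𝓝 (D.d 0 v)) :=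
          ((D.continuous_d hn 0).tendsto v).comp hlim
        have hLlim : Tendsto (fun h => |pansuD (f i) p (hdil (rh h) (xh h))|) atTop
            (𝓝 |pansuD (f i) p v|) :=
          (((continuous_pansuD (f i) p).abs).tendsto v).comp hlim
        set M := D.d 0 v + 1 with hM
        have hM0 : 0 < M := by have := D.nonneg 0 v; positivity
        have hNev : ∀ᶠ h in atTop, D.d 0 (hdil (rh h) (xh h)) < M :=
          hNlim.eventually_lt_const (by linarith)
        have hle : ∀ η > 0, |pansuD (f i) p v| ≤ η := by
          intro η hη
          obtain ⟨r, hr, hpan⟩ := pansu_diff hn D hU hpU hC1 hfp (η := η / M) (by positivity)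
          refine le_of_tendsto hLlim ?_
          filter_upwards [hNev, hrh.eventually_gt_atTop 0, hrh.eventually_gt_atTop (M / r)]
            with h h1 h2 h3
          obtain ⟨q, hqb, hq⟩ := hxE h
          have hq' : hmul p (xh h) = q := by rw [← hq]; exact hmul_hinv_cancel p q
          rw [D.N_hdil h2] at h1
          have hsm : D.d 0 (xh h) < r := by
            rw [div_lt_iff₀ hr] at h3
            exact lt_of_mul_lt_mul_left (h1.trans h3) h2.le
          obtain ⟨hqU, hinc⟩ := hpan (xh h) hsm
          rw [hq'] at hqU hinc
          have h4 := hinc i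
          rw [bdry_zero q hqU hqb i, zero_sub, abs_neg] at h4
          rw [pansuD_hdil, abs_mul, abs_of_pos h2]
          calc rh h * |pansuD (f i) p (xh h)| ≤ rh h * (η / M * D.d 0 (xh h)) := by gcongr
            _ = η / M * (rh h * D.d 0 (xh h)) := by ring
            _ ≤ η / M * M := by gcongr
            _ = η := by field_simp
        have := le_of_forall_gt_imp_ge_of_dense hle
        exact abs_eq_zero.1 (le_antisymm this (abs_nonneg _))
      exact ⟨fun i => hvan _, hvan _⟩
    · rintro ⟨hv0, hvl⟩
      have hv : ∀ i, pansuD (f i) p v = 0 := forall_fin_succ_last hv0 hvl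
      obtain ⟨r, hr, C, hC, hreg⟩ := metric_regular hn D hU hpU hC1 hli'
      have hbdry : ∀ q ∈ U, D.d p q < r → (∀ i, f i q = 0) → q ∈ bdry S := by
        intro q hq hqr hq0
        refine ⟨mem_closure_iff_nhds.2 fun V hV => ?_, fun h => ?_⟩
        · obtain ⟨s, hs, hsV⟩ := D.exists_ball hn q hV
          set t := min s r / (2 * C) with ht
          have ht0 : 0 < t := by positivity
          let τ : Fin (k+1) → ℝ := fun i => if i = Fin.last k then t else 0
          have hτ : ‖(fun i => f i q) - τ‖ ≤ t := by
            refine (pi_norm_le_iff_of_nonneg ht0.le).2 fun i => ?_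
            simp only [Pi.sub_apply, hq0, zero_sub, norm_neg, τ]
            split_ifs
            · rw [Real.norm_of_nonneg ht0.le]
            · simpa using ht0.le
          have hm0 : 0 < min s r := lt_min hs hr
          have hCt : C * ‖(fun i => f i q) - τ‖ < min s r := by
            calc _ ≤ C * t := by gcongr
              _ = min s r / 2 := by rw [ht]; field_simp
              _ < _ := by linarith
          obtain ⟨q', hq'U, hd, hq'⟩ := hreg q τ hqr (hCt.trans_le (min_le_right _ _))
          refine ⟨q', hsV q' (lt_of_le_of_lt hd (hCt.trans_le (min_le_left _ _))),
            (memS q' hq'U).2 ⟨fun i => ?_, ?_⟩⟩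
          · have h0 : i.castSucc ≠ Fin.last k := (Fin.castSucc_lt_last i).ne
            rw [hq']; simp only [τ, if_neg h0]
          · rw [hq']; simpa only [τ, if_true] using ht0
        · have := ((memS q hq).1 h).2
          rw [hq0] at this
          exact lt_irrefl _ this
      have hex : ∀ h : ℕ, ∃ x : Hpt n, ∃ ρ : ℝ, x ∈ (fun q => hmul (hinv p) q) '' bdry S ∧
          (h : ℝ) ≤ ρ ∧ D.d v (hdil ρ x) < 1 / ((h : ℝ) + 1) := by
        intro h
        have hR : 0 < D.d 0 v + 1 := by have := D.nonneg 0 v; positivity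
        have hε : (0:ℝ) < 1 / ((h : ℝ) + 1) := by positivity
        obtain ⟨l0, hl0, hlift⟩ := lift_point hn D hU hpU hC1 hli' hfp hR hε
        set L := min (l0 / 2) (min (1 / ((h : ℝ) + 1)) (r / (2 * (D.d 0 v + 1)))) with hL
        have hL0 : 0 < L := by positivity
        obtain ⟨q, hqU, hq, hd⟩ := hlift L hL0
          (lt_of_le_of_lt (min_le_left _ _) (by linarith)) v (by linarith)
        have hLh : L ≤ 1 / ((h : ℝ) + 1) := (min_le_right _ _).trans (min_le_left _ _)
        have hLr : L * (2 * (D.d 0 v + 1)) ≤ r :=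
          (le_div_iff₀ (by positivity)).1 ((min_le_right _ _).trans (min_le_right _ _))
        have hle1 : 1 / ((h : ℝ) + 1) ≤ 1 := by
          rw [div_le_one (by positivity)]; linarith [(Nat.cast_nonneg h : (0:ℝ) ≤ h)]
        refine ⟨hmul (hinv p) q, L⁻¹, ⟨q, hbdry q hqU ?_ fun i => ?_, rfl⟩, ?_, hd⟩
        · have h1 : D.d p q = L * D.d 0 (hdil L⁻¹ (hmul (hinv p) q)) := by
            rw [← D.N_hdil hL0, hdil_hdil_inv hL0, ← D.d_eq]
          have h2 := D.triangle 0 v (hdil L⁻¹ (hmul (hinv p) q))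
          have h3 : D.d 0 (hdil L⁻¹ (hmul (hinv p) q)) < 2 * (D.d 0 v + 1) := by linarith
          rw [h1]
          exact (mul_lt_mul_of_pos_left h3 hL0).trans_le hLr
        · rw [hq, hv, mul_zero]
        · have h1 : (h : ℝ) + 1 ≤ L⁻¹ := by
            rw [le_inv_comm₀ (by positivity) hL0]; simpa using hLh
          linarith
      choose xh rh h1 h2 h3 using hex
      refine ⟨xh, rh, h1, tendsto_atTop_mono h2 tendsto_natCast_atTop_atTop, ?_⟩
      rw [tendsto_def]
      intro V hV
      obtain ⟨s, hs, hsV⟩ := D.exists_ball hn v hV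
      have h4 := (tendsto_one_div_add_atTop_nhds_zero_nat (𝕜 := ℝ)).eventually_lt_const hs
      filter_upwards [h4] with h hh
      exact hsV _ ((h3 h).trans hh)

end Heis
end
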